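/- arXiv:1811.09053 — 4 statements merged into one kernel-verified Lean document; each statement's English description precedes it below -/
import Mathlib

section
/- For every ω_c > 0 and every t ∈ ℝ, the improper integral ∫₀^∞ e^{−ω/ω_c} · (ωt − sin(ωt))/ω dω converges and equals ω_c·t − arctan(ω_c·t). Consequently, for the Ohmic spectral density J(ω) = ω·e^{−ω/ω_c}, the dephasing phase θ(t) = 4∫₀^∞ (J(ω)/ω²)(ωt − sin ωt) dω equals 4ω_c t − 4 arctan(ω_c t). -/
open MeasureTheory

theorem integrableOn_exp_neg_div {c : ℝ} (hc : 0 < c) :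
    IntegrableOn (fun x : ℝ => Real.exp (-x / c)) (Set.Ioi 0) := by
  have h := integrableOn_exp_mul_Ioi (a := -(1 / c)) (by simpa using hc) 0
  refine h.congr_fun (fun x _ => ?_) measurableSet_Ioi
  change Real.exp _ = Real.exp _
  congr 1
  ring

theorem exp_mul_complex_eq (c t x : ℝ) :
    (Complex.exp ((-(1 / c : ℝ) + t * Complex.I) * x)).re =
      Real.exp (-x / c) * Real.cos (x * t) := by
  rw [Complex.exp_re]
  congr 2
  · simp
    ring
  · simp
    ring

theorem integrableOn_exp_neg_div_mul_cos {c : ℝ} (hc : 0 < c) (t : ℝ) :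
    IntegrableOn (fun x : ℝ => Real.exp (-x / c) * Real.cos (x * t)) (Set.Ioi 0) := by
  refine (integrableOn_exp_neg_div hc).mul_bdd (c := 1) (by fun_prop) ?_
  exact Filter.Eventually.of_forall fun x => Real.abs_cos_le_one _

theorem integral_exp_neg_div_mul_cos {c : ℝ} (hc : 0 < c) (t : ℝ) :
    ∫ x in Set.Ioi (0 : ℝ), Real.exp (-x / c) * Real.cos (x * t) =
      c / (1 + (c * t) ^ 2) := by
  have ha : (-(1 / c : ℝ) + t * Complex.I).re < 0 := by simpa using hc
  have hint := integrableOn_exp_mul_complex_Ioi ha 0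
  have hre : ∫ x in Set.Ioi (0 : ℝ),
      (Complex.exp ((-(1 / c : ℝ) + t * Complex.I) * x)).re =
      (∫ x in Set.Ioi (0 : ℝ), Complex.exp ((-(1 / c : ℝ) + t * Complex.I) * x)).re :=
    integral_re hint
  simp only [exp_mul_complex_eq] at hre
  rw [hre, integral_exp_mul_complex_Ioi ha]
  have h : (1 + (c * t) ^ 2 : ℝ) ≠ 0 := by positivity
  have h' : c⁻¹ * c⁻¹ + t * t ≠ 0 := by
    have := mul_self_nonneg t
    positivity
  simp [Complex.div_re, Complex.normSq_apply]
  field_simp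

theorem integral_exp_neg_div_mul_one_sub_cos {c : ℝ} (hc : 0 < c) (t : ℝ) :
    ∫ x in Set.Ioi (0 : ℝ), Real.exp (-x / c) * (1 - Real.cos (x * t)) =
      c - c / (1 + (c * t) ^ 2) := by
  have h0 := integral_exp_neg_div_mul_cos hc 0
  simp only [mul_zero, Real.cos_zero, mul_one] at h0
  simp only [mul_sub, mul_one]
  rw [integral_sub (integrableOn_exp_neg_div hc) (integrableOn_exp_neg_div_mul_cos hc t), h0,
    integral_exp_neg_div_mul_cos hc t]
  simp

theorem integrableOn_exp_neg_div_mul_sub_sin_div {c : ℝ} (hc : 0 < c) (t : ℝ) :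
    IntegrableOn (fun x : ℝ => Real.exp (-x / c) * (x * t - Real.sin (x * t)) / x)
      (Set.Ioi 0) := by
  simp only [mul_div_assoc]
  refine (integrableOn_exp_neg_div hc).mul_bdd (c := 2 * |t|)
    (by apply Measurable.aestronglyMeasurable; fun_prop) ?_
  refine (ae_restrict_mem measurableSet_Ioi).mono fun x (hx : 0 < x) => ?_
  rw [Real.norm_eq_abs, abs_div, abs_of_pos hx, div_le_iff₀ hx]
  calc |x * t - Real.sin (x * t)| ≤ |x * t| + |Real.sin (x * t)| := abs_sub _ _
    _ ≤ |x * t| + |x * t| := by exact add_le_add le_rfl Real.abs_sin_le_abs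
    _ = 2 * |t| * x := by rw [abs_mul, abs_of_pos hx]; ring

theorem hasDerivAt_integral_exp_neg_div_mul_sub_sin_div {c : ℝ} (hc : 0 < c) (t : ℝ) :
    HasDerivAt
      (fun s : ℝ => ∫ x in Set.Ioi (0 : ℝ), Real.exp (-x / c) * (x * s - Real.sin (x * s)) / x)
      (c - c / (1 + (c * t) ^ 2)) t := by
  rw [← integral_exp_neg_div_mul_one_sub_cos hc t]
  refine (hasDerivAt_integral_of_dominated_loc_of_deriv_le
    (F' := fun s x : ℝ => Real.exp (-x / c) * (1 - Real.cos (x * s)))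
    (bound := fun x => Real.exp (-x / c) * 2)
    Filter.univ_mem
    (Filter.Eventually.of_forall fun s =>
      (integrableOn_exp_neg_div_mul_sub_sin_div hc s).aestronglyMeasurable)
    (integrableOn_exp_neg_div_mul_sub_sin_div hc t) (by fun_prop) ?_
    ((integrableOn_exp_neg_div hc).mul_const 2) ?_).2
  · refine Filter.Eventually.of_forall fun x s _ => ?_
    have h1 := Real.cos_le_one (x * s)
    have h2 := Real.neg_one_le_cos (x * s)
    rw [norm_mul, Real.norm_of_nonneg (Real.exp_pos _).le, Real.norm_of_nonneg (by linarith)]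
    gcongr
    linarith
  · refine (ae_restrict_mem measurableSet_Ioi).mono fun x (hx : 0 < x) s _ => ?_
    have hlin : HasDerivAt (fun s : ℝ => x * s) x s := by
      simpa using (hasDerivAt_id s).const_mul x
    refine (((hlin.sub hlin.sin).const_mul (Real.exp (-x / c))).div_const x).congr_deriv ?_
    field_simp

theorem integral_exp_neg_div_mul_sub_sin_div {c : ℝ} (hc : 0 < c) (t : ℝ) :
    ∫ x in Set.Ioi (0 : ℝ), Real.exp (-x / c) * (x * t - Real.sin (x * t)) / x =
      c * t - Real.arctan (c * t) := by
  have hg : ∀ s : ℝ, HasDerivAt (fun s : ℝ => c * s - Real.arctan (c * s))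
      (c - c / (1 + (c * s) ^ 2)) s := fun s => by
    have hlin : HasDerivAt (fun s : ℝ => c * s) c s := by
      simpa using (hasDerivAt_id s).const_mul c
    refine (hlin.sub hlin.arctan).congr_deriv ?_
    ring
  have hd : ∀ s : ℝ, HasDerivAt _ _ s := fun s =>
    (hasDerivAt_integral_exp_neg_div_mul_sub_sin_div hc s).sub (hg s)
  have h := is_const_of_deriv_eq_zero (fun s => (hd s).differentiableAt)
    (fun s => by rw [(hd s).deriv, sub_self]) t 0
  simpa [sub_eq_zero] using h

/-- For `ω_c > 0` and `t ∈ ℝ`, the integral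
`∫₀^∞ e^{−ω/ω_c} (ωt − sin ωt)/ω dω` converges and equals `ω_c t − arctan(ω_c t)`;
consequently the Ohmic dephasing phase `θ(t) = 4∫₀^∞ (J(ω)/ω²)(ωt − sin ωt) dω` with
`J(ω) = ω e^{−ω/ω_c}` equals `4ω_c t − 4 arctan(ω_c t)`. -/
theorem ohmic_dephasing_phase (ωc t : ℝ) (hωc : 0 < ωc) :
    IntegrableOn (fun ω : ℝ => Real.exp (-ω / ωc) * (ω * t - Real.sin (ω * t)) / ω)
      (Set.Ioi 0) ∧
    (∫ ω in Set.Ioi (0 : ℝ), Real.exp (-ω / ωc) * (ω * t - Real.sin (ω * t)) / ω) =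
      ωc * t - Real.arctan (ωc * t) ∧
    4 * (∫ ω in Set.Ioi (0 : ℝ),
        (ω * Real.exp (-ω / ωc) / ω ^ 2) * (ω * t - Real.sin (ω * t))) =
      4 * (ωc * t) - 4 * Real.arctan (ωc * t) := by
  refine ⟨integrableOn_exp_neg_div_mul_sub_sin_div hωc t,
    integral_exp_neg_div_mul_sub_sin_div hωc t, ?_⟩
  rw [← mul_sub, ← integral_exp_neg_div_mul_sub_sin_div hωc t]
  congr 1
  refine setIntegral_congr_fun measurableSet_Ioi fun x (hx : 0 < x) => ?_
  field_simp
end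

section
/- Let ω_c > 0 and t ∈ ℝ. Then ∫₀^∞ (y³/(6·ω_c⁴)) · e^{−y/ω_c} · e^{−iyt} dy = (1 + i·ω_c·t)^{−4}, and (1 + i·ω_c·t)^{−4} = e^{−4i·arctan(ω_c t)}/(1 + ω_c²t²)². Consequently, the function wp₁(x) = (x + 4ω_c)³ · e^{−(x+4ω_c)/ω_c}/(6·ω_c⁴) for x ≥ −4ω_c (and wp₁(x) = 0 for x < −4ω_c) satisfies ∫_ℝ wp₁(x) e^{−ixt} dx = e^{i(4ω_c t − 4 arctan(ω_c t))}/(1 + ω_c²t²)², which is the dephasing factor φ₁(t) = e^{iθ(t) − Φ(t)} with θ(t) = 4ω_c t − 4 arctan(ω_c t) and Φ(t) = 2 ln(1 + ω_c² t²). -/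
open MeasureTheory

/-- The marginal quasi-distribution `wp₁` for the single-qubit dephasing factor of the
extended spin-boson model with Ohmic spectral density at zero temperature:
`wp₁(x) = (x + 4ω_c)³ e^{−(x+4ω_c)/ω_c}/(6ω_c⁴)` for `x ≥ −4ω_c`, and `0` otherwise. -/
noncomputable def wp1 (ωc x : ℝ) : ℝ :=
  if x < -(4 * ωc) then 0
  else (x + 4 * ωc) ^ 3 * Real.exp (-((x + 4 * ωc) / ωc)) / (6 * ωc ^ 4)

theorem integrableOn_pow_mul_cexp_neg_mul_Ioi (n : ℕ) {z : ℂ} (hz : 0 < z.re) :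
    IntegrableOn (fun y : ℝ => (y : ℂ) ^ n * Complex.exp (-(z * y))) (Set.Ioi 0) := by
  have h := integrableOn_rpow_mul_exp_neg_mul_rpow (s := n) (p := 1) (b := z.re)
    (by have : (0 : ℝ) ≤ n := n.cast_nonneg
        linarith) one_pos hz
  refine h.mono' (by fun_prop) ?_
  filter_upwards [ae_restrict_mem measurableSet_Ioi] with y hy
  have hy' : (0 : ℝ) < y := hy
  simp [Complex.norm_exp, abs_of_pos hy']

theorem tendsto_pow_mul_cexp_neg_mul_atTop (n : ℕ) {z : ℂ} (hz : 0 < z.re) :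
    Filter.Tendsto (fun y : ℝ => (y : ℂ) ^ n * Complex.exp (-(z * y))) Filter.atTop (nhds 0) := by
  rw [tendsto_zero_iff_norm_tendsto_zero]
  refine (tendsto_rpow_mul_exp_neg_mul_atTop_nhds_zero n z.re hz).congr' ?_
  filter_upwards [Filter.eventually_gt_atTop 0] with y hy
  simp [Complex.norm_exp, abs_of_pos hy]

theorem integral_pow_mul_cexp_neg_mul_Ioi (n : ℕ) {z : ℂ} (hz : 0 < z.re) :
    ∫ y in Set.Ioi (0 : ℝ), (y : ℂ) ^ n * Complex.exp (-(z * y)) =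
      (n.factorial : ℂ) / z ^ (n + 1) := by
  have hz0 : z ≠ 0 := by
    rintro rfl
    simp at hz
  have hexp (y : ℝ) : HasDerivAt (fun y : ℝ => Complex.exp (-(z * y)))
      (Complex.exp (-(z * y)) * -(z * 1)) y :=
    (((hasDerivAt_id y).ofReal_comp.const_mul z).neg).cexp
  induction n with
  | zero =>
    have h := integral_Ioi_of_hasDerivAt_of_tendsto' (a := 0) (fun y _ => hexp y)
      (((integrableOn_pow_mul_cexp_neg_mul_Ioi 0 hz).mul_const (-(z * 1))).congr
        (by simp)) (by simpa using tendsto_pow_mul_cexp_neg_mul_atTop 0 hz)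
    rw [integral_mul_const] at h
    simp only [pow_zero, one_mul, zero_add, pow_one, Nat.factorial_zero, Nat.cast_one]
    rw [eq_div_iff hz0]
    simp at h
    exact h
  | succ n ih =>
    have hn := integrableOn_pow_mul_cexp_neg_mul_Ioi n hz
    have hn' := integrableOn_pow_mul_cexp_neg_mul_Ioi (n + 1) hz
    have hderiv (y : ℝ) : HasDerivAt (fun y : ℝ => (y : ℂ) ^ (n + 1) * Complex.exp (-(z * y)))
        ((n + 1 : ℂ) * ((y : ℂ) ^ n * Complex.exp (-(z * y))) -
          z * ((y : ℂ) ^ (n + 1) * Complex.exp (-(z * y)))) y := by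
      convert! ((hasDerivAt_id y).ofReal_comp.pow (n + 1)).mul (hexp y) using 1
      simp
      ring
    have h := integral_Ioi_of_hasDerivAt_of_tendsto' (a := 0) (fun y _ => hderiv y)
      ((hn.const_mul _).sub (hn'.const_mul _)) (tendsto_pow_mul_cexp_neg_mul_atTop (n + 1) hz)
    rw [integral_sub (hn.const_mul _) (hn'.const_mul _), integral_const_mul, integral_const_mul,
      ih] at h
    simp only [Complex.ofReal_zero, ne_eq, Nat.succ_ne_zero, not_false_eq_true, zero_pow, zero_mul,
      sub_zero, sub_eq_zero] at h
    rw [← mul_right_inj' hz0, ← h, Nat.factorial_succ]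
    push_cast
    field_simp
    ring

theorem one_add_I_mul_eq_sqrt_mul_exp_arctan (x : ℝ) :
    1 + Complex.I * x = (√(1 + x ^ 2) : ℝ) * Complex.exp (Complex.I * (Real.arctan x : ℝ)) := by
  have hs : ((√(1 + x ^ 2) : ℝ) : ℂ) ≠ 0 := by
    exact_mod_cast (Real.sqrt_pos.2 (by positivity)).ne'
  rw [mul_comm Complex.I (Real.arctan x : ℂ), Complex.exp_mul_I, ← Complex.ofReal_cos,
    ← Complex.ofReal_sin, Real.cos_arctan, Real.sin_arctan]
  push_cast
  field_simp

theorem inv_one_add_I_mul_pow_four (x : ℝ) :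
    ((1 + Complex.I * x) ^ 4)⁻¹ =
      Complex.exp (-(4 * Complex.I * (Real.arctan x : ℝ))) / (((1 + x ^ 2) ^ 2 : ℝ) : ℂ) := by
  have hs : √(1 + x ^ 2) ^ 4 = (1 + x ^ 2) ^ 2 := by
    rw [show 4 = 2 * 2 from rfl, pow_mul, Real.sq_sqrt (by positivity)]
  rw [one_add_I_mul_eq_sqrt_mul_exp_arctan, mul_pow, ← Complex.ofReal_pow, hs, ← Complex.exp_nat_mul,
    mul_inv, ← Complex.exp_neg, div_eq_inv_mul]
  congr 3
  push_cast
  ring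

theorem integral_gamma_density_mul_cexp (ωc t : ℝ) (hωc : 0 < ωc) :
    (∫ y in Set.Ioi (0 : ℝ),
        ((y ^ 3 / (6 * ωc ^ 4) : ℝ) : ℂ) * (Real.exp (-(y / ωc)) : ℝ) *
          Complex.exp (-(Complex.I * y * t))) =
      ((1 + Complex.I * ωc * t) ^ 4)⁻¹ := by
  have hω : (ωc : ℂ) ≠ 0 := by exact_mod_cast hωc.ne'
  have hre : 0 < (((ωc⁻¹ : ℝ) : ℂ) + Complex.I * t).re := by simpa using hωc
  have hint (y : ℝ) : ((y ^ 3 / (6 * ωc ^ 4) : ℝ) : ℂ) * (Real.exp (-(y / ωc)) : ℝ) *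
      Complex.exp (-(Complex.I * y * t)) = (6 * (ωc : ℂ) ^ 4)⁻¹ *
        ((y : ℂ) ^ 3 * Complex.exp (-((((ωc⁻¹ : ℝ) : ℂ) + Complex.I * t) * y))) := by
    have hexp : Complex.exp (-((((ωc⁻¹ : ℝ) : ℂ) + Complex.I * t) * y)) =
        Complex.exp (-(y / ωc)) * Complex.exp (-(Complex.I * y * t)) := by
      rw [← Complex.exp_add]
      congr 1
      push_cast
      ring
    rw [hexp]
    push_cast
    ring
  have hz : ((ωc⁻¹ : ℝ) : ℂ) + Complex.I * t = (1 + Complex.I * ωc * t) / ωc := by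
    push_cast
    field_simp
  simp_rw [hint]
  rw [integral_const_mul, integral_pow_mul_cexp_neg_mul_Ioi 3 hre, hz, div_pow]
  simp only [Nat.factorial]
  push_cast
  field_simp

theorem integral_wp1_mul_cexp (ωc t : ℝ) :
    (∫ x : ℝ, (wp1 ωc x : ℂ) * Complex.exp (-(Complex.I * x * t))) =
      Complex.exp (4 * Complex.I * ωc * t) *
        ∫ y in Set.Ioi (0 : ℝ), ((y ^ 3 / (6 * ωc ^ 4) : ℝ) : ℂ) * (Real.exp (-(y / ωc)) : ℝ) *
          Complex.exp (-(Complex.I * y * t)) := by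
  rw [← integral_sub_right_eq_self _ (4 * ωc), ← integral_Ici_eq_integral_Ioi,
    ← integral_indicator measurableSet_Ici, ← integral_const_mul]
  congr 1 with y
  by_cases hy : 0 ≤ y
  · have hexp : Complex.exp (-(Complex.I * ((y - 4 * ωc : ℝ) : ℂ) * t)) =
        Complex.exp (4 * Complex.I * ωc * t) * Complex.exp (-(Complex.I * y * t)) := by
      rw [← Complex.exp_add]
      congr 1
      push_cast
      ring
    rw [Set.indicator_of_mem (Set.mem_Ici.2 hy), hexp, wp1, if_neg (by linarith), sub_add_cancel]
    push_cast
    ring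
  · rw [Set.indicator_of_notMem (by simpa using hy), wp1, if_pos (by linarith)]
    simp

/-- `∫₀^∞ (y³/(6ω_c⁴)) e^{−y/ω_c} e^{−iyt} dy = (1 + iω_c t)⁻⁴`, this equals
`e^{−4i·arctan(ω_c t)}/(1 + ω_c²t²)²`, and consequently the Fourier transform of `wp₁` is the
dephasing factor `φ₁(t) = e^{i(4ω_c t − 4 arctan(ω_c t))}/(1 + ω_c²t²)²`. -/
theorem wp1_fourier_transform (ωc t : ℝ) (hωc : 0 < ωc) :
    (∫ y in Set.Ioi (0 : ℝ),
        ((y ^ 3 / (6 * ωc ^ 4) : ℝ) : ℂ) * (Real.exp (-(y / ωc)) : ℝ) *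
          Complex.exp (-(Complex.I * y * t))) =
      ((1 + Complex.I * ωc * t) ^ (4 : ℕ))⁻¹ ∧
    ((1 + Complex.I * ωc * t) ^ (4 : ℕ))⁻¹ =
      Complex.exp (-(4 * Complex.I * (Real.arctan (ωc * t) : ℝ))) /
        (((1 + ωc ^ 2 * t ^ 2) ^ 2 : ℝ) : ℂ) ∧
    (∫ x : ℝ, (wp1 ωc x : ℂ) * Complex.exp (-(Complex.I * x * t))) =
      Complex.exp (Complex.I * ((4 * ωc * t - 4 * Real.arctan (ωc * t) : ℝ) : ℂ)) /
        (((1 + ωc ^ 2 * t ^ 2) ^ 2 : ℝ) : ℂ) := by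
  have harctan : ((1 + Complex.I * ωc * t) ^ (4 : ℕ))⁻¹ =
      Complex.exp (-(4 * Complex.I * (Real.arctan (ωc * t) : ℝ))) /
        (((1 + ωc ^ 2 * t ^ 2) ^ 2 : ℝ) : ℂ) := by
    have h := inv_one_add_I_mul_pow_four (ωc * t)
    rwa [mul_pow, Complex.ofReal_mul, ← mul_assoc] at h
  refine ⟨integral_gamma_density_mul_cexp ωc t hωc, harctan, ?_⟩
  rw [integral_wp1_mul_cexp, integral_gamma_density_mul_cexp ωc t hωc, harctan, ← mul_div_assoc,
    ← Complex.exp_add]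
  congr 2
  push_cast
  ring
end

section
/- For ω_c > 0, the function wp₁ : ℝ → ℝ defined by wp₁(x) = (x + 4ω_c)³ · e^{−(x+4ω_c)/ω_c}/(6·ω_c⁴) for x ≥ −4ω_c and wp₁(x) = 0 for x < −4ω_c is a probability density: wp₁(x) ≥ 0 for all x ∈ ℝ, wp₁ is integrable, and ∫_ℝ wp₁(x) dx = 1. -/
open MeasureTheory

theorem integral_gammaPDFReal_eq_one {a r : ℝ} (ha : 0 < a) (hr : 0 < r) :
    ∫ x, ProbabilityTheory.gammaPDFReal a r x = 1 := by
  rw [integral_eq_lintegral_of_nonneg_ae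
    (Filter.Eventually.of_forall (ProbabilityTheory.gammaPDFReal_nonneg ha hr))
    (ProbabilityTheory.stronglyMeasurable_gammaPDFReal a r).aestronglyMeasurable]
  have h := ProbabilityTheory.lintegral_gammaPDF_eq_one ha hr
  simp only [ProbabilityTheory.gammaPDF] at h
  rw [h, ENNReal.toReal_one]

/-- `wp₁` is a translated gamma density of shape `4` and rate `1 / ω_c`. -/
theorem wp1_eq_gammaPDFReal {ωc : ℝ} (hωc : 0 < ωc) (x : ℝ) :
    wp1 ωc x = ProbabilityTheory.gammaPDFReal 4 ωc⁻¹ (x + 4 * ωc) := by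
  have hΓ : Real.Gamma 4 = 6 := by
    rw [show (4 : ℝ) = (3 : ℕ) + 1 by norm_num, Real.Gamma_nat_eq_factorial]
    norm_num [Nat.factorial]
  have h3 : (4 : ℝ) - 1 = (3 : ℕ) := by norm_num
  have h4 : (4 : ℝ) = (4 : ℕ) := by norm_num
  have hpow : ωc⁻¹ ^ (4 : ℝ) = ωc⁻¹ ^ 4 := by rw [h4, Real.rpow_natCast]
  unfold wp1 ProbabilityTheory.gammaPDFReal
  rw [hΓ, h3, Real.rpow_natCast, hpow]
  by_cases hx : x < -(4 * ωc)
  · rw [if_pos hx, if_neg (by linarith)]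
  · rw [if_neg hx, if_pos (by linarith), div_eq_inv_mul (x + 4 * ωc)]
    field_simp

/-- For `ω_c > 0`, `wp₁` is a legitimate probability density:
nonnegative, integrable, and normalized to `1`. -/
theorem wp1_is_probability_density (ωc : ℝ) (hωc : 0 < ωc) :
    (∀ x : ℝ, 0 ≤ wp1 ωc x) ∧ Integrable (wp1 ωc) ∧ (∫ x : ℝ, wp1 ωc x) = 1 := by
  have h_eq : wp1 ωc = fun x => ProbabilityTheory.gammaPDFReal 4 ωc⁻¹ (x + 4 * ωc) :=
    funext (wp1_eq_gammaPDFReal hωc)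
  have h_int : (∫ x : ℝ, wp1 ωc x) = 1 := by
    rw [h_eq, integral_add_right_eq_self (ProbabilityTheory.gammaPDFReal 4 ωc⁻¹)]
    exact integral_gammaPDFReal_eq_one (by norm_num) (inv_pos.mpr hωc)
  refine ⟨fun x => ?_, .of_integral_ne_zero (by rw [h_int]; exact one_ne_zero), h_int⟩
  rw [wp1_eq_gammaPDFReal hωc]
  exact ProbabilityTheory.gammaPDFReal_nonneg (by norm_num) (inv_pos.mpr hωc) _
end

section
/- Fix ω_c > 0 and define θ(t) = 4ω_c t − 4 arctan(ω_c t), Φ(t) = 2 ln(1 + ω_c² t²), φ₁(t) = e^{iθ(t) − Φ(t)}, φ₁₃(t) = e^{−iθ(t) − Φ(t)}, and φ₉(t) = e^{−4Φ(t)}. Then for every real t ≠ 0, φ₁(t)·φ₁₃(t) ≠ φ₉(t). In words: for the qubit-pair pure dephasing with Ohmic spectral density at zero temperature, the dephasing factor φ₉ does not factorize as the product φ₁·φ₁₃, so the random variables of the simulating Hamiltonian-ensemble representation are correlated. -/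
noncomputable section

/-- Dephasing phase `θ(t) = 4ω_c t − 4 arctan(ω_c t)` of the Ohmic spin-boson model. -/
def dephTheta (ωc t : ℝ) : ℝ := 4 * ωc * t - 4 * Real.arctan (ωc * t)

/-- Zero-temperature Ohmic dephasing exponent `Φ(t) = 2 ln(1 + ω_c²t²)`. -/
def dephPhi (ωc t : ℝ) : ℝ := 2 * Real.log (1 + ωc ^ 2 * t ^ 2)

/-- Dephasing factor `φ₁(t) = e^{iθ(t) − Φ(t)}`. -/
def phi1 (ωc t : ℝ) : ℂ := Complex.exp (Complex.I * (dephTheta ωc t : ℝ) - (dephPhi ωc t : ℝ))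

/-- Dephasing factor `φ₁₃(t) = e^{−iθ(t) − Φ(t)}`. -/
def phi13 (ωc t : ℝ) : ℂ :=
  Complex.exp (-(Complex.I * (dephTheta ωc t : ℝ)) - (dephPhi ωc t : ℝ))

/-- Dephasing factor `φ₉(t) = e^{−4Φ(t)}`. -/
def phi9 (ωc t : ℝ) : ℂ := Complex.exp (-(4 * (dephPhi ωc t : ℝ)))

/-- The exponent `Φ` is strictly positive away from `t = 0`. -/
lemma dephPhi_pos {ωc t : ℝ} (hωc : ωc ≠ 0) (ht : t ≠ 0) : 0 < dephPhi ωc t := by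
  have h : 0 < ωc ^ 2 * t ^ 2 := by positivity
  exact mul_pos two_pos (Real.log_pos (by linarith))

/-- The phases cancel in `φ₁·φ₁₃`, leaving `e^{−2Φ}`. -/
lemma phi1_mul_phi13 (ωc t : ℝ) :
    phi1 ωc t * phi13 ωc t = (Real.exp (-(2 * dephPhi ωc t)) : ℂ) := by
  rw [phi1, phi13, ← Complex.exp_add]
  push_cast
  ring_nf

/-- `φ₉` is real. -/
lemma phi9_eq_ofReal (ωc t : ℝ) : phi9 ωc t = (Real.exp (-(4 * dephPhi ωc t)) : ℂ) := by
  rw [phi9]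
  push_cast
  rfl

/-- For the qubit-pair pure dephasing with Ohmic spectral density at zero
temperature, the dephasing factor `φ₉` does not factorize as `φ₁·φ₁₃` at any `t ≠ 0`, so the
random variables of the simulating Hamiltonian-ensemble representation are correlated. -/
theorem phi9_not_factorized (ωc : ℝ) (hωc : 0 < ωc) (t : ℝ) (ht : t ≠ 0) :
    phi1 ωc t * phi13 ωc t ≠ phi9 ωc t := by
  rw [phi1_mul_phi13, phi9_eq_ofReal, Ne, Complex.ofReal_inj, Real.exp_eq_exp]
  have := dephPhi_pos hωc.ne' ht
  intro h
  linarith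
end
end
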